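/- Let V be a real inner product space and let R ⊆ V be a root system all of whose elements have square length 1 or 2. Then there do not exist vectors β, α₁, α₂, α₃, α₄, α₅ ∈ V such that: the 20 vectors ε·αᵢ + ε′·β (1 ≤ i ≤ 5, ε, ε′ ∈ {1, −1}) are pairwise distinct and all lie in R; β = α₁ + α₂ + α₃; ⟨β, αᵢ⟩ = 1/4 for i = 1, 2, 3; ⟨β, α₄⟩ = ⟨β, α₅⟩ = 0; and ‖β + α₄‖² = ‖β + α₅‖² = 1. -/

import Mathlib

open scoped RealInnerProductSpace

/-- A root system in a real inner product space `V`: a finite set `R ⊆ V` with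
`0 ∉ R` (R1), the only multiples of a root in `R` being `±` that root (R2),
integrality of `2⟨α,β⟩/⟨α,α⟩` (R3), and stability under reflections (R4). -/
def IsRootSystem {V : Type*} [NormedAddCommGroup V] [InnerProductSpace ℝ V]
    (R : Set V) : Prop :=
  R.Finite ∧ (0 : V) ∉ R ∧
  (∀ a ∈ R, ∀ t : ℝ, t • a ∈ R → t • a = a ∨ t • a = -a) ∧
  (∀ a ∈ R, ∀ b ∈ R, ∃ k : ℤ, 2 * ⟪a, b⟫ / ⟪a, a⟫ = (k : ℝ)) ∧
  (∀ a ∈ R, ∀ b ∈ R, b - (2 * ⟪a, b⟫ / ⟪a, a⟫) • a ∈ R)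

/-- `S` is a closed subset of the root system `R`: whenever `x, y ∈ S` and
`x + y ∈ R`, also `x + y ∈ S`. -/
def IsClosedIn {V : Type*} [NormedAddCommGroup V] [InnerProductSpace ℝ V]
    (R S : Set V) : Prop :=
  ∀ x ∈ S, ∀ y ∈ S, x + y ∈ R → x + y ∈ S

theorem statement13 {V : Type*} [NormedAddCommGroup V] [InnerProductSpace ℝ V]
    (R : Set V) (hR : IsRootSystem R)
    (hlen : ∀ r ∈ R, ⟪r, r⟫ = 1 ∨ ⟪r, r⟫ = 2) :
    ¬ ∃ (β : V) (α : Fin 5 → V),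
      (∀ i j : Fin 5, ∀ ε₁ ε₂ η₁ η₂ : ℝ,
        (ε₁ = 1 ∨ ε₁ = -1) → (ε₂ = 1 ∨ ε₂ = -1) → (η₁ = 1 ∨ η₁ = -1) → (η₂ = 1 ∨ η₂ = -1) →
        ε₁ • α i + ε₂ • β = η₁ • α j + η₂ • β → i = j ∧ ε₁ = η₁ ∧ ε₂ = η₂) ∧
      (∀ i : Fin 5, ∀ ε₁ ε₂ : ℝ, (ε₁ = 1 ∨ ε₁ = -1) → (ε₂ = 1 ∨ ε₂ = -1) →
        ε₁ • α i + ε₂ • β ∈ R) ∧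
      β = α 0 + α 1 + α 2 ∧
      ⟪β, α 0⟫ = 1 / 4 ∧ ⟪β, α 1⟫ = 1 / 4 ∧ ⟪β, α 2⟫ = 1 / 4 ∧
      ⟪β, α 3⟫ = 0 ∧ ⟪β, α 4⟫ = 0 ∧
      ‖β + α 3‖ ^ 2 = 1 ∧ ‖β + α 4‖ ^ 2 = 1 := by
  rintro ⟨β, α, hdist, hmem, hβ, h0, h1, h2, h3, h4, hn3, hn4⟩
  obtain ⟨-, -, -, hint, -⟩ := hR
  have hββ : ⟪β, β⟫ = 3 / 4 := by
    have h : ⟪β, β⟫ = ⟪β, α 0 + α 1 + α 2⟫ := congrArg (fun x => ⟪β, x⟫) hβ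
    rw [h, inner_add_right, inner_add_right, h0, h1, h2]
    norm_num
  have h33 : ⟪α 3, α 3⟫ = 1 / 4 := by
    rw [← real_inner_self_eq_norm_sq, real_inner_add_add_self] at hn3
    linarith
  have h44 : ⟪α 4, α 4⟫ = 1 / 4 := by
    rw [← real_inner_self_eq_norm_sq, real_inner_add_add_self] at hn4
    linarith
  have hmem3 : β + α 3 ∈ R := by
    simpa [add_comm] using hmem 3 1 1 (Or.inl rfl) (Or.inl rfl)
  have hmem4 : β + α 4 ∈ R := by
    simpa [add_comm] using hmem 4 1 1 (Or.inl rfl) (Or.inl rfl)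
  obtain ⟨k, hk⟩ := hint _ hmem3 _ hmem4
  rw [real_inner_self_eq_norm_sq, hn3, div_one, inner_add_left, inner_add_right,
    inner_add_right, hββ, h4, real_inner_comm, h3] at hk
  have hsub : ⟪α 3 - α 4, α 3 - α 4⟫ = 1 / 2 - 2 * ⟪α 3, α 4⟫ := by
    rw [real_inner_sub_sub_self]
    linarith
  have hadd : ⟪α 3 + α 4, α 3 + α 4⟫ = 1 / 2 + 2 * ⟪α 3, α 4⟫ := by
    rw [real_inner_add_add_self]
    linarith
  have hsub0 : 0 ≤ ⟪α 3 - α 4, α 3 - α 4⟫ := real_inner_self_nonneg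
  have hadd0 : 0 ≤ ⟪α 3 + α 4, α 3 + α 4⟫ := real_inner_self_nonneg
  have hk1 : 1 ≤ k := by
    have : (1 : ℝ) ≤ k := by linarith
    exact_mod_cast this
  have hk2 : k ≤ 2 := by
    have : (k : ℝ) ≤ 2 := by linarith
    exact_mod_cast this
  obtain rfl | rfl : k = 1 ∨ k = 2 := by omega
  · have h : α 3 + α 4 = 0 := inner_self_eq_zero (𝕜 := ℝ).1 (by push_cast at hk; linarith)
    have := hdist 3 4 1 1 (-1) 1 (by simp) (by simp) (by simp) (by simp)
      (by simp [eq_neg_of_add_eq_zero_left h])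
    exact absurd this.1 (by decide)
  · have h : α 3 - α 4 = 0 := inner_self_eq_zero (𝕜 := ℝ).1 (by push_cast at hk; linarith)
    have := hdist 3 4 1 1 1 1 (by simp) (by simp) (by simp) (by simp)
      (by simp [sub_eq_zero.1 h])
    exact absurd this.1 (by decide)
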